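/- Let A be an associative unital ring, V and V′ A-modules, and σ : V[F_μ] → V′[F_μ] an A[F_μ]-linear map such that the augmentation ε(σ) : V → V′ is an isomorphism. Then σ is injective and, for every n ≥ 0, the induced map V[F_μ]/(I^n·V[F_μ]) → V′[F_μ]/(I^n·V′[F_μ]) is bijective (so σ induces an isomorphism of I-adic completions). -/

import Mathlib

open Finsupp

noncomputable section

/-- The free group `F_μ` on `μ` generators. -/
abbrev FG (μ : ℕ) : Type := FreeGroup (Fin μ)

/-- The group ring `A[F_μ]`. -/
abbrev GR (μ : ℕ) (A : Type*) [Ring A] : Type _ := MonoidAlgebra A (FG μ)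

/-- The augmentation ring homomorphism `ε : A[F_μ] → A` sending every element of `F_μ` to `1`. -/
def aug (μ : ℕ) (A : Type*) [Ring A] : GR μ A →+* A :=
  MonoidAlgebra.liftNCRingHom (RingHom.id A) 1 (fun x y => by simp)


section ExtMod

variable (μ : ℕ) (A : Type*) [Ring A]
variable {V V' : Type*} [AddCommGroup V] [Module A V] [AddCommGroup V'] [Module A V']

/-- Left translation action of `F_μ` on `V[F_μ] = FG μ →₀ V`. -/
def shiftEnd : FG μ →* AddMonoid.End (FG μ →₀ V) where
  toFun g := Finsupp.mapDomain.addMonoidHom (fun h => g * h)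
  map_one' := by
    apply AddMonoidHom.ext
    intro f
    show Finsupp.mapDomain (fun h => (1:FG μ) * h) f = f
    simp only [one_mul]
    exact Finsupp.mapDomain_id
  map_mul' g₁ g₂ := by
    apply AddMonoidHom.ext
    intro f
    show Finsupp.mapDomain (fun h => (g₁ * g₂) * h) f
      = Finsupp.mapDomain (fun h => g₁ * h) (Finsupp.mapDomain (fun h => g₂ * h) f)
    rw [show (fun h => g₁ * g₂ * h) = (fun h => g₁ * h) ∘ (fun h => g₂ * h) from
      funext fun h => mul_assoc g₁ g₂ h, Finsupp.mapDomain_comp]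

/-- The ring homomorphism `A[F_μ] →+* End(V[F_μ])` inducing the module structure on
`V[F_μ] = A[F_μ] ⊗_A V`, realised as `FG μ →₀ V`. -/
def extScalarHom : GR μ A →+* AddMonoid.End (FG μ →₀ V) :=
  MonoidAlgebra.liftNCRingHom (Module.toAddMonoidEnd A (FG μ →₀ V)) (shiftEnd μ)
    (fun a g => by
      apply AddMonoidHom.ext
      intro f
      show a • (Finsupp.mapDomain _ f) = Finsupp.mapDomain _ (a • f)
      exact (Finsupp.mapDomain_smul a f).symm)

/-- The `A[F_μ]`-module structure on `V[F_μ] = FG μ →₀ V` induced from the `A`-module `V`. -/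
instance extModule : Module (GR μ A) (FG μ →₀ V) :=
  Module.compHom (FG μ →₀ V) (extScalarHom μ A (V := V))

/-- The augmentation `ε(σ) : V → V'` of an `A[F_μ]`-linear map `σ : V[F_μ] → V'[F_μ]`,
obtained by applying `A ⊗_{A[F_μ]} -`. -/
def augMap (σ : (FG μ →₀ V) →ₗ[GR μ A] (FG μ →₀ V')) : V → V' :=
  fun v => (σ (Finsupp.single 1 v)).sum fun _ w => w

end ExtMod



/-- The chain of submodules `I^n·V[F_μ] ⊆ V[F_μ]`, where `I = ker ε` is the augmentation
ideal of `A[F_μ]`. -/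
def Ipow (μ : ℕ) (A : Type*) [Ring A] (V : Type*) [AddCommGroup V] [Module A V] :
    ℕ → Submodule (GR μ A) (FG μ →₀ V)
  | 0 => ⊤
  | n + 1 => Submodule.span (GR μ A)
      {x | ∃ a ∈ RingHom.ker (aug μ A), ∃ y ∈ Ipow μ A V n, x = a • y}

section Fox

variable {μ : ℕ} {A : Type*} [Ring A]
variable {V V' : Type*} [AddCommGroup V] [Module A V] [AddCommGroup V'] [Module A V']

@[simp]
theorem aug_single (g : FG μ) (c : A) : aug μ A (MonoidAlgebra.single g c) = c := by
  simp [aug, MonoidAlgebra.liftNCRingHom]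

@[simp]
theorem shiftEnd_single (g h : FG μ) (v : V) :
    shiftEnd μ g (Finsupp.single h v) = Finsupp.single (g * h) v :=
  Finsupp.mapDomain_single

theorem shiftEnd_apply (g h : FG μ) (x : FG μ →₀ V) : shiftEnd μ g x h = x (g⁻¹ * h) := by
  have := Finsupp.mapDomain_apply (mul_right_injective g) x (g⁻¹ * h)
  rwa [mul_inv_cancel_left] at this

theorem shiftEnd_mul_apply (g h : FG μ) (x : FG μ →₀ V) :
    shiftEnd μ (g * h) x = shiftEnd μ g (shiftEnd μ h x) := by
  rw [map_mul]
  rfl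

theorem shiftEnd_one_apply (x : FG μ →₀ V) : shiftEnd μ 1 x = x := by
  rw [map_one]
  rfl

theorem single_smul_eq (g : FG μ) (c : A) (x : FG μ →₀ V) :
    (MonoidAlgebra.single g c : GR μ A) • x = c • shiftEnd μ g x := by
  have h : extScalarHom μ A (V := V) (MonoidAlgebra.single g c)
      = Module.toAddMonoidEnd A (FG μ →₀ V) c * shiftEnd μ g :=
    MonoidAlgebra.liftNC_single _ _ _ _
  exact DFunLike.congr_fun h x

theorem shiftEnd_mem (N : Submodule (GR μ A) (FG μ →₀ V)) (g : FG μ) {x : FG μ →₀ V}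
    (hx : x ∈ N) : shiftEnd μ g x ∈ N := by
  simpa [single_smul_eq] using N.smul_mem (MonoidAlgebra.single g (1 : A)) hx

theorem smul_mem_of_mem (N : Submodule (GR μ A) (FG μ →₀ V)) (c : A) {x : FG μ →₀ V}
    (hx : x ∈ N) : c • x ∈ N := by
  simpa [single_smul_eq] using N.smul_mem (MonoidAlgebra.single (1 : FG μ) c) hx

theorem map_shiftEnd (σ : (FG μ →₀ V) →ₗ[GR μ A] (FG μ →₀ V')) (g : FG μ) (x : FG μ →₀ V) :
    σ (shiftEnd μ g x) = shiftEnd μ g (σ x) := by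
  simpa [single_smul_eq] using σ.map_smul (MonoidAlgebra.single g (1 : A)) x

/-- The augmentation `V[F_μ] → V`, adding up all coefficients. -/
def coeffSum (μ : ℕ) (V : Type*) [AddCommGroup V] : (FG μ →₀ V) →+ V :=
  Finsupp.liftAddHom fun _ => AddMonoidHom.id V

@[simp]
theorem coeffSum_single (g : FG μ) (v : V) : coeffSum μ V (Finsupp.single g v) = v := by
  simp [coeffSum]

theorem coeffSum_shiftEnd (g : FG μ) (x : FG μ →₀ V) :
    coeffSum μ V (shiftEnd μ g x) = coeffSum μ V x := by
  induction x using Finsupp.induction_linear with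
  | zero => simp
  | add x y hx hy => simp [hx, hy]
  | single h v => simp

theorem coeffSum_coeff_smul (c : A) (x : FG μ →₀ V) :
    coeffSum μ V (c • x) = c • coeffSum μ V x := by
  induction x using Finsupp.induction_linear with
  | zero => simp
  | add x y hx hy => simp [hx, hy]
  | single h v => simp

theorem coeffSum_smul (a : GR μ A) (x : FG μ →₀ V) :
    coeffSum μ V (a • x) = aug μ A a • coeffSum μ V x := by
  induction a using MonoidAlgebra.induction_linear with
  | zero => simp
  | add a b ha hb => simp [add_smul, ha, hb]
  | single g c => simp [single_smul_eq, coeffSum_coeff_smul, coeffSum_shiftEnd]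

theorem augMap_eq (σ : (FG μ →₀ V) →ₗ[GR μ A] (FG μ →₀ V')) (v : V) :
    augMap μ A σ v = coeffSum μ V' (σ (Finsupp.single 1 v)) := by
  rfl

theorem coeffSum_map (σ : (FG μ →₀ V) →ₗ[GR μ A] (FG μ →₀ V')) (x : FG μ →₀ V) :
    coeffSum μ V' (σ x) = augMap μ A σ (coeffSum μ V x) := by
  rw [augMap_eq]
  induction x using Finsupp.induction_linear with
  | zero => simp
  | add x y hx hy => simp [hx, hy, Finsupp.single_add]
  | single g v =>
    have h : (Finsupp.single g v : FG μ →₀ V) = shiftEnd μ g (Finsupp.single 1 v) := by simp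
    rw [h, map_shiftEnd, coeffSum_shiftEnd, ← h, coeffSum_single]

/-- The left Fox derivative with respect to `z_i` of a word, with coefficient in `V`. -/
def foxWord (i : Fin μ) : List (Fin μ × Bool) → V →+ (FG μ →₀ V)
  | [] => 0
  | (j, b) :: L => foxWord i L + if j = i then
      (if b then (Finsupp.singleAddHom (FreeGroup.mk L) : V →+ (FG μ →₀ V))
        else -(Finsupp.singleAddHom (FreeGroup.mk ((j, b) :: L)) : V →+ (FG μ →₀ V))) else 0

theorem foxWord_step (i : Fin μ) {L₁ L₂ : List (Fin μ × Bool)}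
    (h : FreeGroup.Red.Step L₁ L₂) :
    foxWord (V := V) i L₁ = foxWord i L₂ := by
  obtain @⟨L, M, j, b⟩ := h
  have hred : ∀ c, (FreeGroup.mk ((j, c) :: (j, !c) :: M) : FG μ) = FreeGroup.mk M :=
    fun c => Quot.sound FreeGroup.Red.Step.cons_not
  induction L with
  | nil =>
    by_cases hj : j = i <;> cases b <;> simp [foxWord, hj]
    · have := hred false
      simp only [hj, Bool.not_false] at this
      simp [this]
  | cons t L ih =>
    obtain ⟨k, c⟩ := t
    have h₁ : (FreeGroup.mk (L ++ (j, b) :: (j, !b) :: M) : FG μ) = FreeGroup.mk (L ++ M) :=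
      Quot.sound FreeGroup.Red.Step.not
    have h₂ : (FreeGroup.mk ((k, c) :: (L ++ (j, b) :: (j, !b) :: M)) : FG μ)
        = FreeGroup.mk ((k, c) :: (L ++ M)) :=
      Quot.sound (FreeGroup.Red.Step.not (L₁ := (k, c) :: L))
    simp only [List.cons_append, foxWord, ih, h₁, h₂]

/-- The left Fox derivative with respect to `z_i` on `V[F_μ]`. -/
def fox (V : Type*) [AddCommGroup V] (i : Fin μ) : (FG μ →₀ V) →+ (FG μ →₀ V) :=
  Finsupp.liftAddHom (Quot.lift (foxWord i) fun _ _ => foxWord_step i)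

theorem fox_single_mk (i : Fin μ) (L : List (Fin μ × Bool)) (v : V) :
    fox V i (Finsupp.single (FreeGroup.mk L) v) = foxWord i L v :=
  Finsupp.liftAddHom_apply_single _ _ _

@[simp]
theorem fox_single_one (i : Fin μ) (v : V) : fox V i (Finsupp.single 1 v) = 0 :=
  fox_single_mk i [] v

theorem fox_shiftEnd_of (i j : Fin μ) (x : FG μ →₀ V) :
    fox V i (shiftEnd μ (FreeGroup.of j) x) = fox V i x + if j = i then x else 0 := by
  induction x using Finsupp.induction_linear with
  | zero => simp
  | add x y hx hy =>
    simp only [map_add, hx, hy]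
    split_ifs <;> abel
  | single g v =>
    obtain ⟨L, rfl⟩ : ∃ L, FreeGroup.mk L = g := ⟨_, FreeGroup.mk_toWord⟩
    rw [shiftEnd_single]
    change fox V i (Finsupp.single (FreeGroup.mk ((j, true) :: L)) v)
      = fox V i (Finsupp.single (FreeGroup.mk L) v)
        + if j = i then Finsupp.single (FreeGroup.mk L) v else 0
    rw [fox_single_mk, fox_single_mk, foxWord, if_pos rfl]
    split_ifs <;> simp

theorem fox_coeff_smul (i : Fin μ) (c : A) (x : FG μ →₀ V) :
    fox V i (c • x) = c • fox V i x := by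
  induction x using Finsupp.induction_linear with
  | zero => simp
  | add x y hx hy => simp [hx, hy]
  | single g v =>
    obtain ⟨L, rfl⟩ : ∃ L, FreeGroup.mk L = g := ⟨_, FreeGroup.mk_toWord⟩
    rw [Finsupp.smul_single, fox_single_mk, fox_single_mk]
    induction L with
    | nil => simp [foxWord]
    | cons t L ih =>
      obtain ⟨j, b⟩ := t
      simp only [foxWord, AddMonoidHom.add_apply, ih, smul_add]
      split_ifs <;> simp

/-- The fundamental formula of the Fox calculus. -/
theorem fox_formula (x : FG μ →₀ V) :
    x = Finsupp.single 1 (coeffSum μ V x)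
      + ∑ i, (shiftEnd μ (FreeGroup.of i) (fox V i x) - fox V i x) := by
  induction x using Finsupp.induction_linear with
  | zero => simp
  | add x y hx hy =>
    nth_rewrite 1 [hx, hy]
    simp only [map_add, Finsupp.single_add, Finset.sum_add_distrib, Finset.sum_sub_distrib]
    abel
  | single g v =>
    obtain ⟨L, rfl⟩ : ∃ L, FreeGroup.mk L = g := ⟨_, FreeGroup.mk_toWord⟩
    simp only [fox_single_mk, coeffSum_single]
    induction L with
    | nil => simp [foxWord, FreeGroup.one_eq_mk]
    | cons t L ih =>
      obtain ⟨j, b⟩ := t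
      have hsum : ∀ i, shiftEnd μ (FreeGroup.of i) (foxWord i ((j, b) :: L) v)
          - foxWord i ((j, b) :: L) v
          = (shiftEnd μ (FreeGroup.of i) (foxWord i L v) - foxWord i L v)
            + if j = i then Finsupp.single (FreeGroup.mk ((j, b) :: L)) v
              - Finsupp.single (FreeGroup.mk L) v else 0 := by
        intro i
        simp only [foxWord, AddMonoidHom.add_apply, map_add]
        split_ifs with hj hb
        · subst hj hb
          simp [FreeGroup.of]
          abel
        · subst hj
          obtain rfl : b = false := by simpa using hb
          have : (FreeGroup.of j * FreeGroup.mk ((j, false) :: L) : FG μ) = FreeGroup.mk L :=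
            Quot.sound FreeGroup.Red.Step.cons_not
          simp [this]
          abel
        · simp
      rw [Finset.sum_congr rfl fun i _ => hsum i, Finset.sum_add_distrib, ← add_assoc, ← ih]
      simp

theorem fox_shiftEnd_sub_mem (N : Submodule (GR μ A) (FG μ →₀ V)) (i : Fin μ) (g : FG μ)
    {x : FG μ →₀ V} (hx : x ∈ N) : fox V i (shiftEnd μ g x) - fox V i x ∈ N := by
  have key : ∀ j, ∀ y ∈ N, fox V i (shiftEnd μ (FreeGroup.of j) y) - fox V i y ∈ N := by
    intro j y hy
    rw [fox_shiftEnd_of, add_sub_cancel_left]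
    split_ifs
    exacts [hy, N.zero_mem]
  induction g using FreeGroup.induction_on generalizing x with
  | C1 => simp
  | of j => exact key j x hx
  | inv_of j _ =>
    have := key j _ (shiftEnd_mem N (FreeGroup.of j)⁻¹ hx)
    rw [← shiftEnd_mul_apply, mul_inv_cancel, shiftEnd_one_apply] at this
    simpa using N.neg_mem this
  | mul g h hg hh =>
    rw [shiftEnd_mul_apply]
    simpa using N.add_mem (hg (shiftEnd_mem N h hx)) (hh hx)

theorem fox_smul_sub_mem (N : Submodule (GR μ A) (FG μ →₀ V)) (i : Fin μ) (a : GR μ A)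
    {x : FG μ →₀ V} (hx : x ∈ N) : fox V i (a • x) - aug μ A a • fox V i x ∈ N := by
  induction a using MonoidAlgebra.induction_linear with
  | zero => simp
  | add a b ha hb =>
    convert N.add_mem ha hb using 1
    simp only [add_smul, map_add]
    abel
  | single g c =>
    rw [single_smul_eq, aug_single, fox_coeff_smul, ← smul_sub]
    exact smul_mem_of_mem N c (fox_shiftEnd_sub_mem N i g hx)

theorem mem_Ipow_succ {n : ℕ} {x : FG μ →₀ V} :
    x ∈ Ipow μ A V (n + 1) ↔ coeffSum μ V x = 0 ∧ ∀ i, fox V i x ∈ Ipow μ A V n := by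
  constructor
  · intro hx
    suffices h : coeffSum μ V x = 0 ∧ x ∈ Ipow μ A V n ∧ ∀ i, fox V i x ∈ Ipow μ A V n from
      ⟨h.1, h.2.2⟩
    rw [Ipow] at hx
    induction hx using Submodule.span_induction with
    | mem x hx =>
      obtain ⟨a, ha, y, hy, rfl⟩ := hx
      rw [RingHom.mem_ker] at ha
      refine ⟨by rw [coeffSum_smul, ha, zero_smul], Submodule.smul_mem _ _ hy, fun i => ?_⟩
      simpa [ha] using fox_smul_sub_mem _ i a hy
    | zero => simp
    | add x y _ _ hx hy =>
      exact ⟨by simp [hx.1, hy.1], add_mem hx.2.1 hy.2.1,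
        fun i => by simpa using add_mem (hx.2.2 i) (hy.2.2 i)⟩
    | smul r x _ hx =>
      refine ⟨by rw [coeffSum_smul, hx.1, smul_zero], Submodule.smul_mem _ _ hx.2.1, fun i => ?_⟩
      simpa using add_mem (fox_smul_sub_mem _ i r hx.2.1)
        (smul_mem_of_mem _ (aug μ A r) (hx.2.2 i))
  · rintro ⟨h₀, h⟩
    rw [fox_formula x, h₀, Finsupp.single_zero, zero_add, Ipow]
    refine Submodule.sum_mem _ fun i _ => Submodule.subset_span
      ⟨MonoidAlgebra.single (FreeGroup.of i) 1 - MonoidAlgebra.single 1 1, ?_, _, h i, ?_⟩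
    · simp [RingHom.mem_ker]
    · simp [sub_smul, single_smul_eq]

theorem fox_sum_shiftEnd_sub (i : Fin μ) (w : Fin μ → FG μ →₀ V) :
    fox V i (∑ j, (shiftEnd μ (FreeGroup.of j) (w j) - w j)) = w i := by
  simp [fox_shiftEnd_of, Finset.sum_add_distrib]

theorem coeffSum_sum_shiftEnd_sub (w : Fin μ → FG μ →₀ V) :
    coeffSum μ V (∑ j, (shiftEnd μ (FreeGroup.of j) (w j) - w j)) = 0 := by
  simp [coeffSum_shiftEnd]

theorem map_sum_shiftEnd_sub (σ : (FG μ →₀ V) →ₗ[GR μ A] (FG μ →₀ V'))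
    (w : Fin μ → FG μ →₀ V) :
    σ (∑ j, (shiftEnd μ (FreeGroup.of j) (w j) - w j))
      = ∑ j, (shiftEnd μ (FreeGroup.of j) (σ (w j)) - σ (w j)) := by
  simp [map_shiftEnd]

theorem fox_map (σ : (FG μ →₀ V) →ₗ[GR μ A] (FG μ →₀ V')) {x : FG μ →₀ V}
    (hx : coeffSum μ V x = 0) (i : Fin μ) : fox V' i (σ x) = σ (fox V i x) := by
  conv_lhs => rw [fox_formula x, hx, Finsupp.single_zero, zero_add, map_sum_shiftEnd_sub,
    fox_sum_shiftEnd_sub]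

/-- The Fox derivative with respect to a letter `s = z_i^{±1}`, taken with respect to the basis
of the augmentation ideal in which `z_i - 1` is replaced by `s - 1`, and then translated by `s`:
on a word it adds up the suffixes starting with `s` and subtracts those preceded by `s⁻¹`. -/
def foxLetter (V : Type*) [AddCommGroup V] (s : Fin μ × Bool) : (FG μ →₀ V) →+ (FG μ →₀ V) :=
  if s.2 then (shiftEnd μ (FreeGroup.of s.1)).comp (fox V s.1) else -fox V s.1

theorem foxLetter_true (i : Fin μ) (x : FG μ →₀ V) :
    foxLetter V (i, true) x = shiftEnd μ (FreeGroup.of i) (fox V i x) := rfl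

theorem foxLetter_false (i : Fin μ) (x : FG μ →₀ V) :
    foxLetter V (i, false) x = -fox V i x := rfl

theorem foxLetter_not_eq_zero {s : Fin μ × Bool} {x : FG μ →₀ V}
    (h : foxLetter V (s.1, !s.2) x = 0) : foxLetter V s x = 0 := by
  obtain ⟨i, _ | _⟩ := s
  · ext g
    have := DFunLike.congr_fun h (FreeGroup.of i * g)
    simpa [foxLetter_true, foxLetter_false, shiftEnd_apply] using this
  · have h' : fox V i x = 0 := by simpa [foxLetter_false] using h
    simp [foxLetter_true, h']

theorem foxLetter_single_cons (s t : Fin μ × Bool) (L : List (Fin μ × Bool)) (v : V) :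
    foxLetter V s (Finsupp.single (FreeGroup.mk (t :: L)) v)
      = foxLetter V s (Finsupp.single (FreeGroup.mk L) v)
        + if t = s then Finsupp.single (FreeGroup.mk (t :: L)) v
          else if t = (s.1, !s.2) then -Finsupp.single (FreeGroup.mk L) v else 0 := by
  obtain ⟨i, b⟩ := s
  obtain ⟨j, c⟩ := t
  by_cases hj : j = i
  · subst hj
    have hred : (FreeGroup.of j * FreeGroup.mk ((j, false) :: L) : FG μ) = FreeGroup.mk L :=
      Quot.sound FreeGroup.Red.Step.cons_not
    have hcons : (FreeGroup.of j * FreeGroup.mk L : FG μ) = FreeGroup.mk ((j, true) :: L) := rfl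
    cases b <;> cases c <;>
      simp [foxLetter_true, foxLetter_false, fox_single_mk, foxWord, hred, hcons,
        -FreeGroup.mul_mk, add_comm]
  · cases b <;> simp [foxLetter_true, foxLetter_false, fox_single_mk, foxWord, hj]

@[simp]
theorem foxLetter_single_one (s : Fin μ × Bool) (v : V) :
    foxLetter V s (Finsupp.single 1 v) = 0 := by
  obtain ⟨i, _ | _⟩ := s <;> simp [foxLetter_true, foxLetter_false]

theorem foxLetter_single_apply_of_lt (s : Fin μ × Bool) {L : List (Fin μ × Bool)} (v : V)
    {h : FG μ} (hL : L.length < h.norm) :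
    foxLetter V s (Finsupp.single (FreeGroup.mk L) v) h = 0 := by
  have hne : ∀ M : List (Fin μ × Bool), M.length < h.norm → FreeGroup.mk M ≠ h := by
    rintro M hM rfl
    exact absurd FreeGroup.norm_mk_le (not_le.2 hM)
  induction L with
  | nil => simp [← FreeGroup.one_eq_mk]
  | cons t L ih =>
    have hL' : L.length < h.norm := by simp at hL; omega
    rw [foxLetter_single_cons, Finsupp.add_apply, ih hL']
    split_ifs <;> simp [hne _ hL, hne _ hL']

/-- In top degree, `foxLetter s` picks out the words starting with `s`. -/
theorem foxLetter_apply_of_top (s : Fin μ × Bool) {x : FG μ →₀ V} {h : FG μ}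
    (hx : ∀ g, h.norm < g.norm → x g = 0) :
    foxLetter V s x h = if h.toWord.head? = some s then x h else 0 := by
  have key : ∀ g v, g.norm ≤ h.norm → foxLetter V s (Finsupp.single g v) h
      = if h.toWord.head? = some s then (Finsupp.single g v : FG μ →₀ V) h else 0 := by
    intro g v hg
    rcases hL : g.toWord with _ | ⟨t, L⟩
    · obtain rfl := FreeGroup.toWord_eq_nil_iff.1 hL
      by_cases hh : (1 : FG μ) = h
      · subst hh
        simp
      · simp [hh]
    · have hgL : g = FreeGroup.mk (t :: L) := by rw [← hL, FreeGroup.mk_toWord]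
      have hlt : L.length < h.norm := by
        rw [FreeGroup.norm, hL] at hg
        simpa using hg
      have hne : FreeGroup.mk L ≠ h := by
        rintro rfl
        exact absurd FreeGroup.norm_mk_le (not_le.2 hlt)
      rw [hgL, foxLetter_single_cons, Finsupp.add_apply, foxLetter_single_apply_of_lt s v hlt,
        ← hgL, zero_add]
      by_cases hgh : g = h
      · subst hgh
        by_cases hts : t = s
        · simp [hL, hts]
        · simp only [hL, List.head?_cons, Option.some.injEq, hts, if_false]
          split_ifs <;> simp [hne]
      · split_ifs <;> simp [hgh, hne]
  rw [← Finsupp.sum_single x, Finsupp.sum, map_sum, Finsupp.finsetSum_apply,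
    Finsupp.finsetSum_apply]
  rw [Finset.sum_congr rfl fun g hg => key g (x g) ?_]
  · split_ifs <;> simp
  · by_contra! hlt
    exact Finsupp.mem_support_iff.1 hg (hx g hlt)

theorem map_foxLetter_eq_zero (σ : (FG μ →₀ V) →ₗ[GR μ A] (FG μ →₀ V')) {x : FG μ →₀ V}
    (h₀ : coeffSum μ V x = 0) (hx : σ x = 0) (s : Fin μ × Bool) :
    σ (foxLetter V s x) = 0 := by
  obtain ⟨i, _ | _⟩ := s <;>
    simp [foxLetter_true, foxLetter_false, map_shiftEnd, ← fox_map σ h₀, hx]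

theorem coeffSum_eq_zero_of_map_eq_zero (σ : (FG μ →₀ V) →ₗ[GR μ A] (FG μ →₀ V'))
    (hσ : Function.Injective (augMap μ A σ)) {x : FG μ →₀ V} (hx : coeffSum μ V' (σ x) = 0) :
    coeffSum μ V x = 0 := by
  apply hσ
  rw [← coeffSum_map, hx, augMap_eq]
  simp

theorem eq_zero_of_map_eq_zero (σ : (FG μ →₀ V) →ₗ[GR μ A] (FG μ →₀ V'))
    (hσ : Function.Injective (augMap μ A σ)) (n : ℕ) {x : FG μ →₀ V} (hx : σ x = 0)
    (hn : ∀ g : FG μ, n ≤ g.norm → x g = 0) : x = 0 := by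
  have h₀ : ∀ {y : FG μ →₀ V}, σ y = 0 → coeffSum μ V y = 0 := fun hy =>
    coeffSum_eq_zero_of_map_eq_zero σ hσ (by rw [hy, map_zero])
  induction n generalizing x with
  | zero => exact Finsupp.ext fun g => hn g (Nat.zero_le _)
  | succ n ih =>
    refine ih hx fun h hnh => ?_
    rcases hnh.lt_or_eq with hlt | heq
    · exact hn h hlt
    rcases hL : h.toWord with _ | ⟨s, L⟩
    · obtain rfl := FreeGroup.toWord_eq_nil_iff.1 hL
      have hx1 : x = Finsupp.single 1 (x 1) := by
        ext g
        by_cases hg : g = 1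
        · simp [hg]
        · rw [Finsupp.single_eq_of_ne hg]
          refine hn g ?_
          have := mt FreeGroup.norm_eq_zero.1 hg
          simp at heq
          omega
      simpa [h₀ hx] using (congrArg (coeffSum μ V) hx1).symm
    · have top : ∀ (t : Fin μ × Bool) {y : FG μ →₀ V}, (∀ g : FG μ, n + 1 ≤ g.norm → y g = 0) →
          ∀ g : FG μ, n ≤ g.norm →
            foxLetter V t y g = if g.toWord.head? = some t then y g else 0 :=
        fun t y hy g hg => foxLetter_apply_of_top t fun k hk => hy k (by omega)
      have hy := map_foxLetter_eq_zero σ (h₀ hx) hx s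
      have hyn : ∀ g : FG μ, n + 1 ≤ g.norm → foxLetter V s x g = 0 := fun g hg => by
        rw [top s hn g (by omega), hn g hg, ite_self]
      have hz := ih (map_foxLetter_eq_zero σ (h₀ hy) hy (s.1, !s.2)) fun g hg => by
        rw [top _ hyn g hg, top _ hn g hg]
        split_ifs with h₁ h₂
        · rw [h₁] at h₂
          have := congrArg Prod.snd (Option.some.inj h₂)
          simp at this
        all_goals rfl
      have := DFunLike.congr_fun (foxLetter_not_eq_zero hz) h
      rw [top _ hyn h hnh, top _ hn h hnh] at this
      simpa [hL] using this

theorem map_mem_Ipow (σ : (FG μ →₀ V) →ₗ[GR μ A] (FG μ →₀ V')) (n : ℕ) {x : FG μ →₀ V}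
    (hx : x ∈ Ipow μ A V n) : σ x ∈ Ipow μ A V' n := by
  induction n generalizing x with
  | zero => trivial
  | succ n ih =>
    rw [mem_Ipow_succ] at hx ⊢
    refine ⟨?_, fun i => ?_⟩
    · rw [coeffSum_map, hx.1, augMap_eq]
      simp
    · rw [fox_map σ hx.1]
      exact ih (hx.2 i)

theorem mem_Ipow_of_map_mem (σ : (FG μ →₀ V) →ₗ[GR μ A] (FG μ →₀ V'))
    (hσ : Function.Injective (augMap μ A σ)) (n : ℕ) {x : FG μ →₀ V}
    (hx : σ x ∈ Ipow μ A V' n) : x ∈ Ipow μ A V n := by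
  induction n generalizing x with
  | zero => trivial
  | succ n ih =>
    rw [mem_Ipow_succ] at hx ⊢
    have h₀ := coeffSum_eq_zero_of_map_eq_zero σ hσ hx.1
    exact ⟨h₀, fun i => ih (by rw [← fox_map σ h₀]; exact hx.2 i)⟩

theorem exists_sub_map_mem_Ipow (σ : (FG μ →₀ V) →ₗ[GR μ A] (FG μ →₀ V'))
    (hσ : Function.Surjective (augMap μ A σ)) (n : ℕ) (y : FG μ →₀ V') :
    ∃ x, σ x - y ∈ Ipow μ A V' n := by
  induction n generalizing y with
  | zero => exact ⟨0, trivial⟩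
  | succ n ih =>
    obtain ⟨v, hv⟩ := hσ (coeffSum μ V' y)
    choose w hw using fun i => ih (fox V' i (y - σ (Finsupp.single 1 v)))
    refine ⟨Finsupp.single 1 v + ∑ j, (shiftEnd μ (FreeGroup.of j) (w j) - w j), ?_⟩
    rw [mem_Ipow_succ, map_add, map_sum_shiftEnd_sub]
    refine ⟨?_, fun i => ?_⟩
    · rw [map_sub, map_add, coeffSum_sum_shiftEnd_sub, ← augMap_eq, hv, add_zero, sub_self]
    · convert hw i using 1
      rw [map_sub, map_add, fox_sum_shiftEnd_sub, map_sub]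
      abel

end Fox

/-- If `σ : V[F_μ] → V'[F_μ]` is `A[F_μ]`-linear and `ε(σ) : V → V'` is an
isomorphism, then `σ` is injective and induces a bijection
`V[F_μ]/(I^n·V[F_μ]) → V'[F_μ]/(I^n·V'[F_μ])` for every `n`, hence an isomorphism of `I`-adic
completions. -/
theorem statement3 (μ : ℕ) (A : Type*) [Ring A]
    (V V' : Type*) [AddCommGroup V] [Module A V] [AddCommGroup V'] [Module A V']
    (σ : (FG μ →₀ V) →ₗ[GR μ A] (FG μ →₀ V'))
    (hσ : Function.Bijective (augMap μ A σ)) :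
    Function.Injective σ ∧
    ∀ n : ℕ, ∃ h : Ipow μ A V n ≤ (Ipow μ A V' n).comap σ,
      Function.Bijective (Submodule.mapQ (Ipow μ A V n) (Ipow μ A V' n) σ h) := by
  refine ⟨(injective_iff_map_eq_zero σ).2 fun x hx => ?_, fun n =>
    ⟨fun x hx => map_mem_Ipow σ n hx, ?_, ?_⟩⟩
  · refine eq_zero_of_map_eq_zero σ hσ.1 (x.support.sup FreeGroup.norm + 1) hx fun g hg => ?_
    by_contra hne
    have := Finset.le_sup (f := FreeGroup.norm) (Finsupp.mem_support_iff.2 hne)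
    omega
  · refine (injective_iff_map_eq_zero _).2 fun q hq => ?_
    obtain ⟨x, rfl⟩ := Submodule.mkQ_surjective _ q
    rw [Submodule.mkQ_apply, Submodule.mapQ_apply, Submodule.Quotient.mk_eq_zero] at hq
    rw [Submodule.mkQ_apply, Submodule.Quotient.mk_eq_zero]
    exact mem_Ipow_of_map_mem σ hσ.1 n hq
  · intro q
    obtain ⟨y, rfl⟩ := Submodule.mkQ_surjective _ q
    obtain ⟨x, hx⟩ := exists_sub_map_mem_Ipow σ hσ.2 n y
    exact ⟨Submodule.Quotient.mk x, (Submodule.Quotient.eq _).2 hx⟩
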